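/- Let X ⊆ ℝⁿ be an open set, let 𝒩 be a continuous round cone family on X, and let Y ⊆ X be 𝒩-constructible. Then Par^≺(Y) is nonempty and directed: there exists a partition of Y all of whose members are 𝒩-lenses, and for any two elements {Y_α}, {Y_β} of Par^≺(Y) there exists {Y_γ} ∈ Par^≺(Y) with {Y_α} ⪯ {Y_γ} and {Y_β} ⪯ {Y_γ}. -/

import Mathlib

open Set

noncomputable section

/-- `ℝⁿ`. -/
abbrev Euc (n : ℕ) : Type := EuclideanSpace ℝ (Fin n)

/-- A round cone in `ℝⁿ`: a closed convex set, stable under nonnegative scalar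
multiplication, with nonempty interior, satisfying `N ∩ (-N) = {0}`. -/
def IsRoundCone {n : ℕ} (N : Set (Euc n)) : Prop :=
  IsClosed N ∧ Convex ℝ N ∧ (∀ c : ℝ, 0 ≤ c → ∀ v ∈ N, c • v ∈ N) ∧
    (interior N).Nonempty ∧ N ∩ (-N) = {0}

/-- The fiber `𝒩ₓ` of a cone family at a point `x`. -/
def coneFiber {n : ℕ} (𝒩 : Set (Euc n × Euc n)) (x : Euc n) : Set (Euc n) :=
  {v | (x, v) ∈ 𝒩}

/-- Restriction `𝒩_V := 𝒩 ∩ (V × ℝⁿ)` of a cone family to a subset `V`. -/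
def coneRestrict {n : ℕ} (𝒩 : Set (Euc n × Euc n)) (V : Set (Euc n)) :
    Set (Euc n × Euc n) :=
  𝒩 ∩ (V ×ˢ (univ : Set (Euc n)))

/-- A continuous round cone family on `X ⊆ ℝⁿ`. -/
structure IsConeFam {n : ℕ} (X : Set (Euc n)) (𝒩 : Set (Euc n × Euc n)) : Prop where
  subset : 𝒩 ⊆ X ×ˢ (univ : Set (Euc n))
  closed : ∃ C : Set (Euc n × Euc n), IsClosed C ∧ 𝒩 = C ∩ (X ×ˢ (univ : Set (Euc n)))
  cone : ∀ x ∈ X, IsRoundCone (coneFiber 𝒩 x)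
  lsc : ∀ x ∈ X, ∀ v ∈ interior (coneFiber 𝒩 x),
    ∃ V : Set (Euc n), IsOpen V ∧ x ∈ V ∧ V ⊆ X ∧ ∀ y ∈ V, v ∈ interior (coneFiber 𝒩 y)

/-- A C¹ arc in `X`, given by `γ` together with its derivative `γ'` on `[0,1]`. -/
structure IsC1ArcIn {n : ℕ} (X : Set (Euc n)) (γ γ' : ℝ → Euc n) : Prop where
  maps : ∀ t ∈ Icc (0:ℝ) 1, γ t ∈ X
  deriv : ∀ t ∈ Icc (0:ℝ) 1, HasDerivWithinAt γ (γ' t) (Icc (0:ℝ) 1) t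
  cont : ContinuousOn γ' (Icc (0:ℝ) 1)

/-- `P ⊆ X` is `𝒩`-invariant: every C¹ arc starting in `P` whose velocity lies in
`𝒩_{γ(t)} \ {0}` stays in `P`. -/
def NInvariant {n : ℕ} (X : Set (Euc n)) (𝒩 : Set (Euc n × Euc n))
    (P : Set (Euc n)) : Prop :=
  ∀ γ γ' : ℝ → Euc n, IsC1ArcIn X γ γ' → γ 0 ∈ P →
    (∀ t ∈ Icc (0:ℝ) 1, γ' t ∈ coneFiber 𝒩 (γ t) \ {0}) →
    ∀ t ∈ Icc (0:ℝ) 1, γ t ∈ P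

/-- `𝒩`-open subsets of `X`: open and `𝒩`-invariant. -/
def NOpen {n : ℕ} (X : Set (Euc n)) (𝒩 : Set (Euc n × Euc n)) (U : Set (Euc n)) : Prop :=
  U ⊆ X ∧ IsOpen U ∧ NInvariant X 𝒩 U

/-- An `𝒩`-smooth function on `V`: a C¹ function with `df_x(τ) < 0` for all
`τ ∈ 𝒩ₓ \ {0}`, `x ∈ V`. -/
def NSmoothOn {n : ℕ} (𝒩 : Set (Euc n × Euc n)) (f : Euc n → ℝ) (V : Set (Euc n)) : Prop :=
  ∃ df : Euc n → (Euc n →L[ℝ] ℝ), ContinuousOn df V ∧ (∀ x ∈ V, HasFDerivAt f (df x) x) ∧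
    ∀ x ∈ V, ∀ τ ∈ coneFiber 𝒩 x \ {0}, df x τ < 0

/-- `P` is `𝒩`-small: some open neighborhood of `P` in `X` admits an `𝒩`-smooth function. -/
def NSmall {n : ℕ} (X : Set (Euc n)) (𝒩 : Set (Euc n × Euc n)) (P : Set (Euc n)) : Prop :=
  ∃ (W : Set (Euc n)) (f : Euc n → ℝ), IsOpen W ∧ P ⊆ W ∧ W ⊆ X ∧ NSmoothOn 𝒩 f W

/-- `Z ⊆ X` is `𝒩`-special: every point of the closure of `Z` in `X` has an open
neighborhood `V ⊆ X` on which, for some continuous round cone family `𝒩'` with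
`𝒩_V ⋐ 𝒩'`, the set `Z ∩ V` is locally closed in the `𝒩'`-topology of `V`. -/
def NSpecial {n : ℕ} (X : Set (Euc n)) (𝒩 : Set (Euc n × Euc n)) (Z : Set (Euc n)) : Prop :=
  Z ⊆ X ∧ ∀ x ∈ closure Z ∩ X, ∃ (V : Set (Euc n)) (𝒩' : Set (Euc n × Euc n)),
    IsOpen V ∧ x ∈ V ∧ V ⊆ X ∧ IsConeFam V 𝒩' ∧
    (∀ y ∈ V, coneFiber (coneRestrict 𝒩 V) y \ {0} ⊆ interior (coneFiber 𝒩' y)) ∧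
    ∃ U₁ U₂ : Set (Euc n), NOpen V 𝒩' U₁ ∧ NOpen V 𝒩' U₂ ∧ Z ∩ V = U₁ \ U₂

/-- An `𝒩`-lens: an `𝒩`-special subset whose closure in `X` is compact and `𝒩`-small. -/
def NLens {n : ℕ} (X : Set (Euc n)) (𝒩 : Set (Euc n × Euc n)) (Z : Set (Euc n)) : Prop :=
  NSpecial X 𝒩 Z ∧ IsCompact (closure Z ∩ X) ∧ NSmall X 𝒩 (closure Z ∩ X)

/-- A (finite) partition of a subset `S`: finitely many pairwise disjoint nonempty
subsets with union `S`. -/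
def IsPartitionOf {α : Type*} (S : Set α) (Ps : Set (Set α)) : Prop :=
  Ps.Finite ∧ (∀ A ∈ Ps, A.Nonempty) ∧
    (∀ A ∈ Ps, ∀ B ∈ Ps, A ≠ B → Disjoint A B) ∧ ⋃₀ Ps = S

/-- A partition of `S` comes from a closed filtration: there is a chain
`∅ = F₀ ⊆ … ⊆ F_m = S` of subsets closed in `S` whose nonempty successive
differences are exactly the members of the partition. -/
def ComesFromClosedFiltration {α : Type*} [TopologicalSpace α] (S : Set α)
    (Ps : Set (Set α)) : Prop :=
  ∃ (m : ℕ) (F : ℕ → Set α), F 0 = ∅ ∧ F m = S ∧ (∀ i < m, F i ⊆ F (i + 1)) ∧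
    (∀ i ≤ m, ∃ C : Set α, IsClosed C ∧ F i = C ∩ S) ∧
    Ps = {A | A.Nonempty ∧ ∃ i, 1 ≤ i ∧ i ≤ m ∧ A = F i \ F (i - 1)}

/-- An `𝒩`-special partition of an `𝒩`-lens `Z`: it comes from a closed filtration
of `Z` and each member is an `𝒩`-lens. -/
def NSpecialPartition {n : ℕ} (X : Set (Euc n)) (𝒩 : Set (Euc n × Euc n))
    (Z : Set (Euc n)) (Ps : Set (Set (Euc n))) : Prop :=
  IsPartitionOf Z Ps ∧ ComesFromClosedFiltration Z Ps ∧ ∀ A ∈ Ps, NLens X 𝒩 A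

/-- `𝒩`-constructible subsets: the smallest collection containing all `𝒩`-lenses and
stable under finite unions, intersections and differences. -/
inductive NConstructible {n : ℕ} (X : Set (Euc n)) (𝒩 : Set (Euc n × Euc n)) :
    Set (Euc n) → Prop
  | lens (Z : Set (Euc n)) : NLens X 𝒩 Z → NConstructible X 𝒩 Z
  | union (A B : Set (Euc n)) :
      NConstructible X 𝒩 A → NConstructible X 𝒩 B → NConstructible X 𝒩 (A ∪ B)
  | inter (A B : Set (Euc n)) :
      NConstructible X 𝒩 A → NConstructible X 𝒩 B → NConstructible X 𝒩 (A ∩ B)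
  | diff (A B : Set (Euc n)) :
      NConstructible X 𝒩 A → NConstructible X 𝒩 B → NConstructible X 𝒩 (A \ B)

/-- Membership in `Par^≺(Y)`: a partition of `Y` all of whose members are `𝒩`-lenses. -/
def ParPrec {n : ℕ} (X : Set (Euc n)) (𝒩 : Set (Euc n × Euc n)) (Y : Set (Euc n))
    (Ps : Set (Set (Euc n))) : Prop :=
  IsPartitionOf Y Ps ∧ ∀ A ∈ Ps, NLens X 𝒩 A

/-- The relation `⪯` on `Par^≺(Y)`: `Ps ⪯ Qs` if `Qs` refines `Ps` and for each member
`A` of `Ps` the members of `Qs` contained in `A` form an `𝒩`-special partition of `A`. -/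
def PrecRel {n : ℕ} (X : Set (Euc n)) (𝒩 : Set (Euc n × Euc n))
    (Ps Qs : Set (Set (Euc n))) : Prop :=
  (∀ B ∈ Qs, ∃ A ∈ Ps, B ⊆ A) ∧
    ∀ A ∈ Ps, NSpecialPartition X 𝒩 A {B | B ∈ Qs ∧ B ⊆ A}

section Lens

variable {n : ℕ} {X : Set (Euc n)} {𝒩 : Set (Euc n × Euc n)}

/-- The local condition in the definition of `NSpecial`. -/
def NSpecialAt (X : Set (Euc n)) (𝒩 : Set (Euc n × Euc n)) (Z : Set (Euc n)) (x : Euc n) :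
    Prop :=
  ∃ (V : Set (Euc n)) (𝒩' : Set (Euc n × Euc n)),
    IsOpen V ∧ x ∈ V ∧ V ⊆ X ∧ IsConeFam V 𝒩' ∧
    (∀ y ∈ V, coneFiber (coneRestrict 𝒩 V) y \ {0} ⊆ interior (coneFiber 𝒩' y)) ∧
    ∃ U₁ U₂ : Set (Euc n), NOpen V 𝒩' U₁ ∧ NOpen V 𝒩' U₂ ∧ Z ∩ V = U₁ \ U₂

/-- Near `x`, the set `U` is open for the topology of some larger cone family. -/
def NOpenAt (X : Set (Euc n)) (𝒩 : Set (Euc n × Euc n)) (U : Set (Euc n)) (x : Euc n) :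
    Prop :=
  ∃ (V : Set (Euc n)) (𝒩' : Set (Euc n × Euc n)),
    IsOpen V ∧ x ∈ V ∧ V ⊆ X ∧ IsConeFam V 𝒩' ∧
    (∀ y ∈ V, coneFiber (coneRestrict 𝒩 V) y \ {0} ⊆ interior (coneFiber 𝒩' y)) ∧
    NOpen V 𝒩' (U ∩ V)

theorem nOpen_self {V : Set (Euc n)} (hV : IsOpen V) : NOpen V 𝒩 V :=
  ⟨Subset.rfl, hV, fun _ _ h _ _ => h.maps⟩

theorem nOpen_empty {V : Set (Euc n)} : NOpen V 𝒩 ∅ :=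
  ⟨empty_subset _, isOpen_empty, fun _ _ _ h => absurd h (notMem_empty _)⟩

theorem NOpen.union {V U U' : Set (Euc n)} (h : NOpen V 𝒩 U) (h' : NOpen V 𝒩 U') :
    NOpen V 𝒩 (U ∪ U') :=
  ⟨union_subset h.1 h'.1, h.2.1.union h'.2.1, fun γ γ' hγ h0 hd t ht =>
    h0.imp (fun h0 => h.2.2 γ γ' hγ h0 hd t ht) (fun h0 => h'.2.2 γ γ' hγ h0 hd t ht)⟩

theorem NOpen.inter {V U U' : Set (Euc n)} (h : NOpen V 𝒩 U) (h' : NOpen V 𝒩 U') :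
    NOpen V 𝒩 (U ∩ U') :=
  ⟨inter_subset_left.trans h.1, h.2.1.inter h'.2.1, fun γ γ' hγ h0 hd t ht =>
    ⟨h.2.2 γ γ' hγ h0.1 hd t ht, h'.2.2 γ γ' hγ h0.2 hd t ht⟩⟩

theorem NOpen.restrict {V V' U : Set (Euc n)} {𝒩' : Set (Euc n × Euc n)} (h : NOpen V 𝒩 U)
    (hV' : IsOpen V') (hVV' : V' ⊆ V) (h𝒩 : 𝒩' ⊆ 𝒩) : NOpen V' 𝒩' (U ∩ V') :=
  ⟨inter_subset_right, h.2.1.inter hV', fun γ γ' hγ h0 hd t ht =>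
    ⟨h.2.2 γ γ' ⟨fun t ht => hVV' (hγ.maps t ht), hγ.deriv, hγ.cont⟩ h0.1
      (fun t ht => ⟨h𝒩 (hd t ht).1, (hd t ht).2⟩) t ht, hγ.maps t ht⟩⟩

theorem NOpenAt.nSpecialAt {U : Set (Euc n)} {x : Euc n} (h : NOpenAt X 𝒩 U x) :
    NSpecialAt X 𝒩 U x := by
  obtain ⟨V, 𝒩', hV, hx, hVX, hc, hs, hU⟩ := h
  exact ⟨V, 𝒩', hV, hx, hVX, hc, hs, U ∩ V, ∅, hU, nOpen_empty, by simp⟩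

theorem NOpenAt.nSpecialAt_compl {U : Set (Euc n)} {x : Euc n} (h : NOpenAt X 𝒩 U x) :
    NSpecialAt X 𝒩 Uᶜ x := by
  obtain ⟨V, 𝒩', hV, hx, hVX, hc, hs, hU⟩ := h
  refine ⟨V, 𝒩', hV, hx, hVX, hc, hs, V, U ∩ V, nOpen_self hV, hU, ?_⟩
  ext y
  simp only [mem_inter_iff, mem_compl_iff, mem_sdiff]
  tauto

/-- The fibrewise intersection of two cone families thickening the same family `𝒩`. -/
theorem IsConeFam.inter (h𝒩 : IsConeFam X 𝒩) {V V' : Set (Euc n)}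
    {M M' : Set (Euc n × Euc n)} (hVX : V ⊆ X) (hM : IsConeFam V M) (hM' : IsConeFam V' M')
    (hs : ∀ y ∈ V, coneFiber (coneRestrict 𝒩 V) y \ {0} ⊆ interior (coneFiber M y))
    (hs' : ∀ y ∈ V', coneFiber (coneRestrict 𝒩 V') y \ {0} ⊆ interior (coneFiber M' y)) :
    IsConeFam (V ∩ V') (M ∩ M') := by
  refine ⟨fun p hp => ⟨⟨(hM.subset hp.1).1, (hM'.subset hp.2).1⟩, trivial⟩, ?_, ?_, ?_⟩
  · obtain ⟨C, hC, e⟩ := hM.closed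
    obtain ⟨C', hC', e'⟩ := hM'.closed
    refine ⟨C ∩ C', hC.inter hC', ?_⟩
    ext p
    simp only [e, e', mem_inter_iff, mem_prod, mem_univ, and_true]
    tauto
  · rintro x ⟨hx, hx'⟩
    obtain ⟨c1, c2, c3, c4, c5⟩ := hM.cone x hx
    obtain ⟨d1, d2, d3, d4, d5⟩ := hM'.cone x hx'
    obtain ⟨e1, e2, e3, e4, e5⟩ := h𝒩.cone x (hVX hx)
    change IsRoundCone (coneFiber M x ∩ coneFiber M' x)
    have z : (0 : Euc n) ∈ coneFiber M x := (c5.symm.subset rfl).1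
    have z' : (0 : Euc n) ∈ coneFiber M' x := (d5.symm.subset rfl).1
    refine ⟨c1.inter d1, c2.inter d2,
      fun c hc v hv => ⟨c3 c hc v hv.1, d3 c hc v hv.2⟩, ?_, ?_⟩
    · by_cases hv : ∃ v ∈ coneFiber 𝒩 x, v ≠ 0
      · obtain ⟨v, hv, hv0⟩ := hv
        refine ⟨v, ?_⟩
        rw [interior_inter]
        exact ⟨hs x hx ⟨⟨hv, hx, trivial⟩, hv0⟩, hs' x hx' ⟨⟨hv, hx', trivial⟩, hv0⟩⟩
      · push Not at hv
        refine e4.mono (interior_mono fun v h => ?_)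
        rw [hv v h]
        exact ⟨z, z'⟩
    · refine Subset.antisymm (fun v hv => c5.subset ⟨hv.1.1, hv.2.1⟩) ?_
      rintro v rfl
      exact ⟨⟨z, z'⟩, by simpa using ⟨z, z'⟩⟩
  · rintro x ⟨hx, hx'⟩ v hv
    change v ∈ interior (coneFiber M x ∩ coneFiber M' x) at hv
    rw [interior_inter] at hv
    obtain ⟨O, hO, hxO, hOV, h⟩ := hM.lsc x hx v hv.1
    obtain ⟨O', hO', hxO', hOV', h'⟩ := hM'.lsc x hx' v hv.2
    refine ⟨O ∩ O', hO.inter hO', ⟨hxO, hxO'⟩, inter_subset_inter hOV hOV', fun y hy => ?_⟩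
    change v ∈ interior (coneFiber M y ∩ coneFiber M' y)
    rw [interior_inter]
    exact ⟨h y hy.1, h' y hy.2⟩

theorem NSpecialAt.inter (h𝒩 : IsConeFam X 𝒩) {Z Z' : Set (Euc n)} {x : Euc n}
    (h : NSpecialAt X 𝒩 Z x) (h' : NSpecialAt X 𝒩 Z' x) : NSpecialAt X 𝒩 (Z ∩ Z') x := by
  obtain ⟨V, M, hV, hx, hVX, hc, hs, U₁, U₂, h1, h2, e⟩ := h
  obtain ⟨V', M', hV', hx', hVX', hc', hs', U₁', U₂', h1', h2', e'⟩ := h'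
  have hW := hV.inter hV'
  have r1 := h1.restrict hW inter_subset_left (inter_subset_left (s := M) (t := M'))
  have r2 := h2.restrict hW inter_subset_left (inter_subset_left (s := M) (t := M'))
  have r1' := h1'.restrict hW inter_subset_right (inter_subset_right (s := M) (t := M'))
  have r2' := h2'.restrict hW inter_subset_right (inter_subset_right (s := M) (t := M'))
  refine ⟨V ∩ V', M ∩ M', hW, ⟨hx, hx'⟩, inter_subset_left.trans hVX,
    h𝒩.inter hVX hc hc' hs hs', ?_, _, _, r1.inter r1', r2.union r2', ?_⟩
  · rintro y ⟨hy, hy'⟩ v ⟨hv, hv0⟩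
    change v ∈ interior (coneFiber M y ∩ coneFiber M' y)
    rw [interior_inter]
    exact ⟨hs y hy ⟨⟨hv.1, hy, trivial⟩, hv0⟩, hs' y hy' ⟨⟨hv.1, hy', trivial⟩, hv0⟩⟩
  · ext y
    have a := Set.ext_iff.1 e y
    have a' := Set.ext_iff.1 e' y
    simp only [mem_inter_iff, mem_sdiff, mem_union] at a a' ⊢
    tauto

theorem nLens_empty : NLens X 𝒩 ∅ := by
  refine ⟨⟨empty_subset _, by simp⟩, by simp, ∅, 0, isOpen_empty, by simp, empty_subset _,
    0, continuousOn_empty _, by simp, by simp⟩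

/-- Cutting a lens by a set which is special at all points of the closure. -/
theorem NLens.cut (h𝒩 : IsConeFam X 𝒩) {A E : Set (Euc n)} (hA : NLens X 𝒩 A)
    (hE : ∀ x ∈ closure A ∩ X, NSpecialAt X 𝒩 E x) : NLens X 𝒩 (A ∩ E) := by
  have hcl : closure (A ∩ E) ∩ X ⊆ closure A ∩ X :=
    inter_subset_inter_left _ (closure_mono inter_subset_left)
  obtain ⟨⟨hAX, hsp⟩, hcomp, W, f, hW, hAW, hWX, hf⟩ := hA
  refine ⟨⟨inter_subset_left.trans hAX, fun x hx =>
    NSpecialAt.inter h𝒩 (hsp x (hcl hx)) (hE x (hcl hx))⟩, ?_, W, f, hW, hcl.trans hAW, hWX, hf⟩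
  have : closure (A ∩ E) ∩ X = closure (A ∩ E) ∩ (closure A ∩ X) := by
    ext y
    exact ⟨fun h => ⟨h.1, hcl h⟩, fun h => ⟨h.1, h.2.2⟩⟩
  rw [this]
  exact hcomp.inter_left isClosed_closure

/-- A rank function on `A`: bounded and lower semicontinuous. Its fibres are the strata of a
closed filtration of `A`. -/
def IsRank (A : Set (Euc n)) (ρ : Euc n → ℕ) : Prop :=
  (∃ m, ∀ x ∈ A, ρ x < m) ∧ ∀ x ∈ A, ∃ O, IsOpen O ∧ x ∈ O ∧ ∀ y ∈ A ∩ O, ρ x ≤ ρ y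

theorem IsRank.mono {A B : Set (Euc n)} {ρ : Euc n → ℕ} (h : IsRank A ρ) (hB : B ⊆ A) :
    IsRank B ρ := by
  obtain ⟨⟨m, hm⟩, h⟩ := h
  refine ⟨⟨m, fun x hx => hm x (hB hx)⟩, fun x hx => ?_⟩
  obtain ⟨O, hO, hxO, hy⟩ := h x (hB hx)
  exact ⟨O, hO, hxO, fun y h => hy y ⟨hB h.1, h.2⟩⟩

/-- Lexicographic refinement of a rank function. -/
theorem IsRank.lex {A : Set (Euc n)} {ρ : Euc n → ℕ} {σ : ℕ → Euc n → ℕ} (h : IsRank A ρ)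
    (hσ : ∀ c, IsRank (A ∩ ρ ⁻¹' {c}) (σ c)) :
    ∃ τ, IsRank A τ ∧
      ∀ x ∈ A, ∀ y ∈ A, τ x = τ y ↔ ρ x = ρ y ∧ σ (ρ x) x = σ (ρ x) y := by
  obtain ⟨⟨m, hm⟩, h⟩ := h
  choose k hk using fun c => (hσ c).1
  obtain ⟨K, hK⟩ : ∃ K, ∀ c < m, k c ≤ K :=
    ⟨(Finset.range m).sup k, fun c hc => Finset.le_sup (Finset.mem_range.2 hc)⟩
  have hb : ∀ x ∈ A, σ (ρ x) x < K := fun x hx => (hk _ x ⟨hx, rfl⟩).trans_le (hK _ (hm x hx))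
  have key : ∀ x ∈ A, ∀ y ∈ A, ρ x < ρ y →
      K * ρ x + σ (ρ x) x < K * ρ y + σ (ρ y) y := fun x hx y hy hxy => by
    have := hb x hx
    have : K * (ρ x + 1) ≤ K * ρ y := Nat.mul_le_mul_left _ hxy
    rw [mul_add] at this
    omega
  refine ⟨fun x => K * ρ x + σ (ρ x) x, ⟨⟨K * m + K, fun x hx => ?_⟩, fun x hx => ?_⟩,
    fun x hx y hy => ⟨fun e => ?_, fun e => ?_⟩⟩
  · have := hb x hx
    have := Nat.mul_le_mul_left K (hm x hx).le
    dsimp only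
    omega
  · obtain ⟨O, hO, hxO, hle⟩ := h x hx
    obtain ⟨O', hO', hxO', hle'⟩ := (hσ (ρ x)).2 x ⟨hx, rfl⟩
    refine ⟨O ∩ O', hO.inter hO', ⟨hxO, hxO'⟩, fun y hy => ?_⟩
    rcases (hle y ⟨hy.1, hy.2.1⟩).lt_or_eq with hlt | heq
    · exact (key x hx y hy.1 hlt).le
    · have := hle' y ⟨⟨hy.1, heq.symm⟩, hy.2.2⟩
      simpa [← heq] using this
  · have hρ : ρ x = ρ y := by
      rcases lt_trichotomy (ρ x) (ρ y) with hlt | heq | hlt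
      · exact absurd e (key x hx y hy hlt).ne
      · exact heq
      · exact absurd e (key y hy x hx hlt).ne'
    refine ⟨hρ, ?_⟩
    simpa [← hρ] using e
  · simp only [e.2, ← e.1]

/-- A rank function whose fibres are lenses, and which separates points not related by `Φ`. -/
def IsLensRank (X : Set (Euc n)) (𝒩 : Set (Euc n × Euc n)) (A : Set (Euc n))
    (ρ : Euc n → ℕ) (Φ : Euc n → Euc n → Prop) : Prop :=
  IsRank A ρ ∧ (∀ c, NLens X 𝒩 (A ∩ ρ ⁻¹' {c})) ∧ ∀ x ∈ A, ∀ y ∈ A, ρ x = ρ y → Φ x y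

theorem IsLensRank.trivial {A : Set (Euc n)} (hA : NLens X 𝒩 A) :
    IsLensRank X 𝒩 A 0 (fun _ _ => True) := by
  refine ⟨⟨⟨1, by simp⟩, fun x _ => ⟨univ, isOpen_univ, mem_univ _, by simp⟩⟩, fun c => ?_,
    by simp⟩
  by_cases hc : c = 0
  · subst hc
    simpa [preimage] using hA
  · have : A ∩ (0 : Euc n → ℕ) ⁻¹' {c} = ∅ := by
      ext y
      simp [Ne.symm hc]
    rw [this]
    exact nLens_empty

theorem IsLensRank.lex {A : Set (Euc n)} {ρ : Euc n → ℕ} {Φ Ψ : Euc n → Euc n → Prop}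
    (h : IsLensRank X 𝒩 A ρ Φ)
    (hΨ : ∀ c, ∃ σ, IsLensRank X 𝒩 (A ∩ ρ ⁻¹' {c}) σ Ψ) :
    ∃ τ, IsLensRank X 𝒩 A τ (fun x y => Φ x y ∧ Ψ x y) := by
  choose σ hσ using hΨ
  obtain ⟨τ, hτ, e⟩ := h.1.lex fun c => (hσ c).1
  refine ⟨τ, hτ, fun d => ?_, fun x hx y hy hxy => ?_⟩
  · rcases (A ∩ τ ⁻¹' {d}).eq_empty_or_nonempty with hd | ⟨x, hx, hd⟩
    · rw [hd]
      exact nLens_empty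
    · convert (hσ (ρ x)).2.1 (σ (ρ x) x) using 1
      ext y
      simp only [mem_inter_iff, mem_preimage, mem_singleton_iff] at hd ⊢
      constructor
      · rintro ⟨hy, hyd⟩
        have := (e x hx y hy).1 (hd.trans hyd.symm)
        exact ⟨⟨hy, this.1.symm⟩, this.2.symm⟩
      · rintro ⟨⟨hy, h1⟩, h2⟩
        exact ⟨hy, ((e x hx y hy).2 ⟨h1.symm, h2.symm⟩).symm.trans hd⟩
  · obtain ⟨h1, h2⟩ := (e x hx y hy).1 hxy
    exact ⟨h.2.2 x hx y hy h1, (hσ _).2.2 x ⟨hx, rfl⟩ y ⟨hy, h1.symm⟩ h2⟩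

/-- Every sublens of `A` carries a lens rank function separating points not related by `Φ`. -/
def Separates (X : Set (Euc n)) (𝒩 : Set (Euc n × Euc n)) (A : Set (Euc n))
    (Φ : Euc n → Euc n → Prop) : Prop :=
  ∀ B ⊆ A, NLens X 𝒩 B → ∃ ρ, IsLensRank X 𝒩 B ρ Φ

theorem Separates.mono {A : Set (Euc n)} {Φ Ψ : Euc n → Euc n → Prop}
    (h : Separates X 𝒩 A Φ) (hΦ : ∀ x ∈ A, ∀ y ∈ A, Φ x y → Ψ x y) : Separates X 𝒩 A Ψ := by
  intro B hB hl
  obtain ⟨ρ, h1, h2, h3⟩ := h B hB hl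
  exact ⟨ρ, h1, h2, fun x hx y hy e => hΦ x (hB hx) y (hB hy) (h3 x hx y hy e)⟩

theorem Separates.and {A : Set (Euc n)} {Φ Ψ : Euc n → Euc n → Prop}
    (h : Separates X 𝒩 A Φ) (h' : Separates X 𝒩 A Ψ) :
    Separates X 𝒩 A (fun x y => Φ x y ∧ Ψ x y) := by
  intro B hB hl
  obtain ⟨ρ, hρ⟩ := h B hB hl
  exact hρ.lex fun c => h' _ (inter_subset_left.trans hB) (hρ.2.1 c)

theorem Separates.forall_mem {ι : Type*} {A : Set (Euc n)} {s : Set ι} (hs : s.Finite)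
    {Φ : ι → Euc n → Euc n → Prop} (h : ∀ i ∈ s, Separates X 𝒩 A (Φ i)) :
    Separates X 𝒩 A (fun x y => ∀ i ∈ s, Φ i x y) := by
  induction s, hs using Set.Finite.induction_on with
  | empty => exact fun B _ hl => ⟨0, by simpa using IsLensRank.trivial hl⟩
  | insert _ _ ih =>
    refine ((h _ (mem_insert _ _)).and
      (ih fun i hi => h i (mem_insert_of_mem _ hi))).mono fun x _ y _ hxy => ?_
    simpa [forall_mem_insert] using hxy

theorem separates_of_nOpenAt (h𝒩 : IsConeFam X 𝒩) {A U : Set (Euc n)} (hU : IsOpen U)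
    (h : ∀ x ∈ closure A ∩ X, NOpenAt X 𝒩 U x) :
    Separates X 𝒩 A (fun x y => x ∈ U ↔ y ∈ U) := by
  classical
  intro B hB hl
  have hcl : closure B ∩ X ⊆ closure A ∩ X := inter_subset_inter_left _ (closure_mono hB)
  refine ⟨fun x => if x ∈ U then 1 else 0,
    ⟨⟨2, fun x _ => by dsimp only; split_ifs <;> simp⟩, fun x hx => ?_⟩, fun c => ?_,
    fun x _ y _ e => ?_⟩
  · by_cases hxU : x ∈ U
    · exact ⟨U, hU, hxU, fun y hy => by simp [hxU, hy.2]⟩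
    · exact ⟨univ, isOpen_univ, mem_univ _, fun y _ => by simp [hxU]⟩
  · rcases c with _ | _ | c
    · convert hl.cut h𝒩 fun x hx => (h x (hcl hx)).nSpecialAt_compl using 2
      ext y
      simp
    · convert hl.cut h𝒩 fun x hx => (h x (hcl hx)).nSpecialAt using 2
      ext y
      simp
    · convert nLens_empty using 1
      ext y
      simp only [mem_inter_iff, mem_preimage, mem_singleton_iff, mem_empty_iff_false, iff_false]
      split_ifs <;> simp
  · by_cases hx : x ∈ U <;> by_cases hy : y ∈ U <;> simp_all

/-- A closed convex cone on which a functional is positive can be thickened to a round cone on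
which that functional is still positive. -/
theorem exists_thickening {N : Set (Euc n)} (hN : IsRoundCone N) (l : Euc n →L[ℝ] ℝ)
    (hl : ∀ v ∈ N \ {0}, 0 < l v) :
    ∃ N' : Set (Euc n), IsRoundCone N' ∧ N \ {0} ⊆ interior N' ∧
      ∃ m > 0, ∀ v ∈ N', m * ‖v‖ ≤ l v := by
  obtain ⟨h1, h2, h3, h4, h5⟩ := hN
  have z : (0 : Euc n) ∈ N := (h5.symm.subset rfl).1
  have hl0 : ∀ v ∈ N, 0 ≤ l v := fun v hv => by
    by_cases h : v = 0
    · simp [h]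
    · exact (hl v ⟨hv, h⟩).le
  set N' : Set (Euc n) := {v | Metric.infDist v N ≤ l v} with hN'
  have mem_iff : ∀ v, v ∈ N' ↔ ∃ w ∈ N, ‖v - w‖ ≤ l v := fun v => by
    constructor
    · intro hv
      obtain ⟨w, hw, e⟩ := h1.exists_infDist_eq_dist ⟨0, z⟩ v
      exact ⟨w, hw, by rw [← dist_eq_norm, ← e]; exact hv⟩
    · rintro ⟨w, hw, h⟩
      rw [← dist_eq_norm] at h
      exact (Metric.infDist_le_dist_of_mem hw).trans h
  have hcl : IsClosed N' := isClosed_le (Metric.continuous_infDist_pt N) l.continuous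
  have hpos : ∀ v ∈ N' \ {0}, 0 < l v := by
    rintro v ⟨hv, hv0⟩
    have hv' : Metric.infDist v N ≤ l v := hv
    rcases (Metric.infDist_nonneg.trans hv').lt_or_eq with h | h
    · exact h
    · rw [← h] at hv'
      have : v ∈ N := by
        rw [← h1.closure_eq, Metric.mem_closure_iff_infDist_zero ⟨0, z⟩]
        exact le_antisymm hv' Metric.infDist_nonneg
      exact hl v ⟨this, hv0⟩
  have hNN' : N ⊆ N' := fun v hv => by
    change Metric.infDist v N ≤ l v
    rw [Metric.infDist_zero_of_mem hv]
    exact hl0 v hv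
  refine ⟨N', ⟨hcl, ?_, ?_, h4.mono (interior_mono hNN'), ?_⟩, ?_, ?_⟩
  · intro v hv w hw a b ha hb hab
    rw [mem_iff] at hv hw ⊢
    obtain ⟨v', hv', hvv⟩ := hv
    obtain ⟨w', hw', hww⟩ := hw
    refine ⟨a • v' + b • w', h2 hv' hw' ha hb hab, ?_⟩
    have : a • v + b • w - (a • v' + b • w') = a • (v - v') + b • (w - w') := by module
    rw [this, map_add, map_smul, map_smul]
    refine (norm_add_le _ _).trans (add_le_add ?_ ?_)
    · rw [norm_smul, Real.norm_of_nonneg ha]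
      exact mul_le_mul_of_nonneg_left hvv ha
    · rw [norm_smul, Real.norm_of_nonneg hb]
      exact mul_le_mul_of_nonneg_left hww hb
  · intro c hc v hv
    rw [mem_iff] at hv ⊢
    obtain ⟨w, hw, h⟩ := hv
    refine ⟨c • w, h3 c hc w hw, ?_⟩
    rw [← smul_sub, map_smul, norm_smul, Real.norm_of_nonneg hc]
    exact mul_le_mul_of_nonneg_left h hc
  · refine Subset.antisymm (fun v hv => ?_) ?_
    · by_contra h0
      have a := hpos v ⟨hv.1, h0⟩
      have b := hpos (-v) ⟨hv.2, by simpa using h0⟩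
      rw [map_neg] at b
      linarith
    · rintro v rfl
      exact ⟨hNN' z, by simpa using hNN' z⟩
  · intro v hv
    refine mem_interior.2 ⟨{v | Metric.infDist v N < l v}, fun w hw => ?_, ?_, ?_⟩
    · have hw' : Metric.infDist w N < l w := hw
      exact hw'.le
    · exact isOpen_lt (Metric.continuous_infDist_pt N) l.continuous
    · change Metric.infDist v N < l v
      rw [Metric.infDist_zero_of_mem hv.1]
      exact hl v hv
  · have hK : IsCompact (Metric.sphere (0 : Euc n) 1 ∩ N') :=
      (isCompact_sphere _ _).inter_right hcl
    obtain ⟨m, hm, hmle⟩ : ∃ m > 0, ∀ v ∈ Metric.sphere (0 : Euc n) 1 ∩ N', m ≤ l v := by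
      refine hK.exists_forall_le' l.continuous.continuousOn fun v hv => hpos v ⟨hv.2, ?_⟩
      rintro rfl
      simpa using hv.1
    refine ⟨m, hm, fun v hv => ?_⟩
    by_cases h0 : v = 0
    · simp [h0]
    have hn : 0 < ‖v‖ := norm_pos_iff.2 h0
    have hu : ‖v‖⁻¹ • v ∈ N' := by
      rw [mem_iff] at hv ⊢
      obtain ⟨w, hw, h⟩ := hv
      refine ⟨‖v‖⁻¹ • w, h3 _ (by positivity) w hw, ?_⟩
      rw [← smul_sub, map_smul, norm_smul, Real.norm_of_nonneg (by positivity)]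
      exact mul_le_mul_of_nonneg_left h (by positivity)
    have := hmle _ ⟨by simp [norm_smul, hn.ne'], hu⟩
    rw [map_smul, smul_eq_mul, ← div_eq_inv_mul, le_div_iff₀ hn] at this
    exact this

open scoped Pointwise in
/-- A round cone thickening one fibre of a cone family thickens the nearby fibres. -/
theorem IsConeFam.exists_fiber_subset_interior (h𝒩 : IsConeFam X 𝒩) (hX : IsOpen X)
    {x : Euc n} (hx : x ∈ X) {N' : Set (Euc n)} (hN' : IsRoundCone N')
    (h : coneFiber 𝒩 x \ {0} ⊆ interior N') :
    ∃ O, IsOpen O ∧ x ∈ O ∧ O ⊆ X ∧ ∀ y ∈ O, coneFiber 𝒩 y \ {0} ⊆ interior N' := by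
  obtain ⟨C, hC, e⟩ := h𝒩.closed
  obtain ⟨u, v, hu, -, hxu, hSv, huv⟩ := generalized_tube_lemma (isCompact_singleton (x := x))
    (isCompact_sphere (0 : Euc n) 1)
    (hC.isOpen_compl.union (isOpen_interior.preimage continuous_snd) :
      IsOpen (Cᶜ ∪ Prod.snd ⁻¹' interior N')) (by
      rintro ⟨y, w⟩ ⟨rfl, hw⟩
      by_cases hwC : (y, w) ∈ C
      · refine Or.inr (h ⟨?_, ?_⟩)
        · rw [coneFiber, e]
          exact ⟨hwC, hx, trivial⟩
        · rintro rfl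
          simp at hw
      · exact Or.inl hwC)
  refine ⟨u ∩ X, hu.inter hX, ⟨hxu rfl, hx⟩, inter_subset_right, fun y hy w hw => ?_⟩
  have hw0 : w ≠ 0 := hw.2
  have hn : 0 < ‖w‖ := norm_pos_iff.2 hw0
  have hmem : ‖w‖⁻¹ • w ∈ coneFiber 𝒩 y :=
    (h𝒩.cone y hy.2).2.2.1 _ (by positivity) w hw.1
  have hint : ‖w‖⁻¹ • w ∈ interior N' := by
    have hs : ‖w‖⁻¹ • w ∈ Metric.sphere (0 : Euc n) 1 := by simp [norm_smul, hn.ne']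
    have hmem' : (y, ‖w‖⁻¹ • w) ∈ 𝒩 := hmem
    rw [e] at hmem'
    rcases huv (mk_mem_prod hy.1 (hSv hs)) with hc | hc
    · exact absurd hmem'.1 hc
    · exact hc
  have : w ∈ ‖w‖ • interior N' := ⟨_, hint, by simp [smul_smul, hn.ne']⟩
  rw [← interior_smul₀ hn.ne'] at this
  refine interior_mono ?_ this
  rintro _ ⟨v, hv, rfl⟩
  exact hN'.2.2.1 _ hn.le v hv

theorem isConeFam_const {V N : Set (Euc n)} (hV : IsOpen V) (hN : IsRoundCone N) :
    IsConeFam V (V ×ˢ N) := by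
  have hfib : ∀ x ∈ V, coneFiber (V ×ˢ N) x = N := fun x hx => by
    ext v
    simp [coneFiber, hx]
  refine ⟨prod_mono_right (subset_univ _), ⟨univ ×ˢ N, isClosed_univ.prod hN.1, ?_⟩,
    fun x hx => by rwa [hfib x hx], fun x hx v hv => ⟨V, hV, hx, Subset.rfl, fun y hy => ?_⟩⟩
  · ext p
    simp only [mem_prod, mem_inter_iff, mem_univ, true_and, and_true]
    tauto
  · rwa [hfib y hy, ← hfib x hx]

/-- Sublevel sets of small linear perturbations of an `𝒩`-smooth function are locally open for
larger cone families. -/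
theorem NSmoothOn.exists_nOpenAt (h𝒩 : IsConeFam X 𝒩) (hX : IsOpen X) {W : Set (Euc n)}
    {f : Euc n → ℝ} (hW : IsOpen W) (hWX : W ⊆ X) (hf : NSmoothOn 𝒩 f W) {x : Euc n}
    (hx : x ∈ W) :
    ∃ ε > 0, ∃ O, IsOpen O ∧ x ∈ O ∧ ∀ y ∈ O, ∀ h : Euc n →L[ℝ] ℝ, ‖h‖ ≤ ε →
      ∀ c : ℝ, NOpenAt X 𝒩 (W ∩ {z | f z + h z < c}) y := by
  obtain ⟨df, hdfc, hdf, hneg⟩ := hf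
  obtain ⟨N', hN', hNN', m, hm, hml⟩ := exists_thickening (h𝒩.cone x (hWX hx)) (-df x)
    fun v hv => by simpa using hneg x hx v hv
  obtain ⟨O, hO, hxO, hOX, hON⟩ :=
    h𝒩.exists_fiber_subset_interior hX (hWX hx) hN' hNN'
  have hop : IsOpen (W ∩ df ⁻¹' Metric.ball (df x) (m / 4)) :=
    hdfc.isOpen_inter_preimage hW Metric.isOpen_ball
  set V := O ∩ (W ∩ df ⁻¹' Metric.ball (df x) (m / 4)) with hVdef
  have hV : IsOpen V := hO.inter hop
  have hfib : ∀ y ∈ V, coneFiber (V ×ˢ N') y = N' := fun y hy => by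
    ext v
    simp [coneFiber, hy]
  refine ⟨m / 4, by positivity, V, hV, ⟨hxO, hx, Metric.mem_ball_self (by positivity)⟩,
    fun y hy h hh c => ⟨V, V ×ˢ N', hV, hy, inter_subset_left.trans hOX,
      isConeFam_const hV hN', fun y hy v hv => ?_, inter_subset_right, ?_, ?_⟩⟩
  · rw [hfib y hy]
    exact hON y hy.1 ⟨hv.1.1, hv.2⟩
  · have hc : ContinuousOn (fun z => f z + h z) W := fun z hz =>
      ((hdf z hz).continuousAt.add h.continuous.continuousAt).continuousWithinAt
    exact (hc.isOpen_inter_preimage hW isOpen_Iio).inter hV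
  · intro γ γ' hγ h0 hd t ht
    refine ⟨⟨(hγ.maps t ht).2.1, ?_⟩, hγ.maps t ht⟩
    have hder : ∀ s ∈ Icc (0 : ℝ) 1, HasDerivWithinAt (fun s => f (γ s) + h (γ s))
        ((df (γ s) + h) (γ' s)) (Icc 0 1) s := fun s hs =>
      (((hdf _ (hγ.maps s hs).2.1).add h.hasFDerivAt).comp_hasDerivWithinAt s (hγ.deriv s hs) :)
    have hanti : AntitoneOn (fun s => f (γ s) + h (γ s)) (Icc (0 : ℝ) 1) := by
      refine antitoneOn_of_hasDerivWithinAt_nonpos (convex_Icc 0 1)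
        (fun s hs => (hder s hs).continuousWithinAt)
        (fun s hs => (hder s (interior_subset hs)).mono interior_subset) fun s hs => ?_
      have hs := interior_subset hs
      obtain ⟨hv, -⟩ := hd s hs
      have hV' := hγ.maps s hs
      rw [hfib _ hV'] at hv
      have h1 := hml _ hv
      have h2 : ‖df (γ s) - df x‖ < m / 4 := by simpa [dist_eq_norm] using hV'.2.2
      have h3 := ((df (γ s) - df x).le_opNorm (γ' s)).trans
        (mul_le_mul_of_nonneg_right h2.le (norm_nonneg _))
      have h4 := (h.le_opNorm (γ' s)).trans (mul_le_mul_of_nonneg_right hh (norm_nonneg _))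
      have h5 := (le_abs_self _).trans h3
      have h6 := (le_abs_self _).trans h4
      simp only [_root_.sub_apply, _root_.neg_apply,
        _root_.add_apply] at h1 h5 ⊢
      have h7 : 0 ≤ m * ‖γ' s‖ := by positivity
      linarith
    exact (hanti (left_mem_Icc.2 zero_le_one) ht ht.1).trans_lt h0.1.2

theorem NLens.subset_closure_inter {A : Set (Euc n)} (hA : NLens X 𝒩 A) : A ⊆ closure A ∩ X :=
  fun _ hx => ⟨subset_closure hx, hA.1.1 hx⟩

/-- Cutting a lens along the level sets of a function all of whose sublevel sets are open for
larger cone families. -/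
theorem separates_abs_sub_le (h𝒩 : IsConeFam X 𝒩) {A W : Set (Euc n)} (hA : NLens X 𝒩 A)
    (hW : IsOpen W) (hAW : closure A ∩ X ⊆ W) {g : Euc n → ℝ} (hg : ContinuousOn g W)
    (h : ∀ x ∈ closure A ∩ X, ∀ c : ℝ, NOpenAt X 𝒩 (W ∩ {z | g z < c}) x) {s : ℝ}
    (hs : 0 < s) : Separates X 𝒩 A (fun x y => |g x - g y| ≤ s) := by
  obtain ⟨M, hM⟩ := hA.2.1.exists_bound_of_continuousOn (hg.mono hAW)
  have hAK := hA.subset_closure_inter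
  have key : ∀ x ∈ A, ∀ y ∈ A, (∀ k ∈ Icc (⌊-M / s⌋ + 1) (⌊M / s⌋ + 1),
      (x ∈ W ∩ {z | g z < k * s} ↔ y ∈ W ∩ {z | g z < k * s})) → g y - g x ≤ s := by
    intro x hx y hy hxy
    have hb := abs_le.1 (hM x (hAK hx))
    have hk := hxy (⌊g x / s⌋ + 1)
      ⟨by gcongr; exact hb.1, by gcongr; exact hb.2⟩
    have h1 : g x < ((⌊g x / s⌋ + 1 : ℤ) : ℝ) * s := by
      rw [← div_lt_iff₀ hs]
      push_cast
      exact Int.lt_floor_add_one _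
    have h2 : ((⌊g x / s⌋ + 1 : ℤ) : ℝ) * s ≤ g x + s := by
      have := mul_le_mul_of_nonneg_right (Int.floor_le (g x / s)) hs.le
      rw [div_mul_cancel₀ _ hs.ne'] at this
      push_cast
      linarith
    have h3 : g y < ((⌊g x / s⌋ + 1 : ℤ) : ℝ) * s := (hk.1 ⟨hAW (hAK hx), h1⟩).2
    linarith
  refine (Separates.forall_mem (finite_Icc (⌊-M / s⌋ + 1) (⌊M / s⌋ + 1)) fun k _ =>
    separates_of_nOpenAt h𝒩 (hg.isOpen_inter_preimage hW (isOpen_Iio (a := (k * s : ℝ))))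
      fun x hx => h x hx _).mono fun x hx y hy hxy => abs_sub_le_iff.2
      ⟨key y hy x hx fun k hk => (hxy k hk).symm, key x hx y hy hxy⟩

/-- A lens can be cut into arbitrarily small lenses. -/
theorem NLens.separates_dist_le (h𝒩 : IsConeFam X 𝒩) (hX : IsOpen X) {A : Set (Euc n)}
    (hA : NLens X 𝒩 A) {δ : ℝ} (hδ : 0 < δ) :
    Separates X 𝒩 A (fun x y => dist x y ≤ δ) := by
  obtain ⟨-, hK, W, f, hW, hKW, hWX, hf⟩ := id hA
  have hfc : ContinuousOn f W := by
    obtain ⟨df, -, hdf, -⟩ := hf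
    exact fun z hz => (hdf z hz).continuousAt.continuousWithinAt
  obtain ⟨ε, hε, hopen⟩ : ∃ ε > 0, ∀ y ∈ closure A ∩ X, ∀ h : Euc n →L[ℝ] ℝ, ‖h‖ ≤ ε →
      ∀ c : ℝ, NOpenAt X 𝒩 (W ∩ {z | f z + h z < c}) y := by
    refine hK.induction_on
      (p := fun s => ∃ ε > 0, ∀ y ∈ s, ∀ h : Euc n →L[ℝ] ℝ, ‖h‖ ≤ ε →
        ∀ c : ℝ, NOpenAt X 𝒩 (W ∩ {z | f z + h z < c}) y) ⟨1, one_pos, by simp⟩ ?_ ?_ ?_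
    · rintro s t hst ⟨ε, hε, h⟩
      exact ⟨ε, hε, fun y hy => h y (hst hy)⟩
    · rintro s t ⟨ε, hε, h⟩ ⟨ε', hε', h'⟩
      refine ⟨min ε ε', lt_min hε hε', ?_⟩
      rintro y (hy | hy) l hl
      · exact h y hy l (hl.trans (min_le_left _ _))
      · exact h' y hy l (hl.trans (min_le_right _ _))
    · intro x hx
      obtain ⟨ε, hε, O, hO, hxO, h⟩ := hf.exists_nOpenAt h𝒩 hX hW hWX (hKW hx)
      exact ⟨O, mem_nhdsWithin_of_mem_nhds (hO.mem_nhds hxO), ε, hε, h⟩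
  have hlin : ∀ l : Euc n →L[ℝ] ℝ, ∀ s : ℝ, 0 < s →
      Separates X 𝒩 A (fun x y => |l x - l y| ≤ s) := by
    intro l s hs
    set a : ℝ := ε / (‖l‖ + 1)
    have ha : 0 < a := by positivity
    have hal : ‖a • l‖ ≤ ε := by
      rw [norm_smul, Real.norm_of_nonneg ha.le, div_mul_eq_mul_div, div_le_iff₀ (by positivity)]
      exact mul_le_mul_of_nonneg_left (by linarith) hε.le
    have hs' : 0 < a * s / 2 := by positivity
    have h0 := separates_abs_sub_le h𝒩 hA hW hKW hfc
      (fun x hx c => by simpa using hopen x hx 0 (by simpa using hε.le) c) hs'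
    have h1 := separates_abs_sub_le h𝒩 hA hW hKW (g := fun z => f z + (a • l) z)
      (hfc.add (a • l).continuous.continuousOn) (fun x hx c => hopen x hx _ hal c) hs'
    refine (h0.and h1).mono fun x _ y _ ⟨e0, e1⟩ => ?_
    have : a * |l x - l y| ≤ a * s := by
      rw [← abs_of_pos ha, ← abs_mul, abs_of_pos ha]
      simp only [_root_.smul_apply, smul_eq_mul] at e1
      rw [abs_le] at e0 e1 ⊢
      constructor <;> linarith [e0.1, e0.2, e1.1, e1.2]
    exact le_of_mul_le_mul_left this ha
  have hs : 0 < δ / (n + 1) := by positivity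
  refine (Separates.forall_mem (finite_univ (α := Fin n)) fun i _ =>
    hlin (EuclideanSpace.proj i) _ hs).mono fun x _ y _ hxy => ?_
  rw [EuclideanSpace.dist_eq]
  calc √(∑ i, dist (x i) (y i) ^ 2) ≤ √((∑ i, dist (x i) (y i)) ^ 2) :=
        Real.sqrt_le_sqrt (Finset.sum_sq_le_sq_sum_of_nonneg fun i _ => dist_nonneg)
    _ = ∑ i, dist (x i) (y i) := Real.sqrt_sq (Finset.sum_nonneg fun i _ => dist_nonneg)
    _ ≤ ∑ _i : Fin n, δ / (n + 1) := Finset.sum_le_sum fun i _ => by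
        simpa [Real.dist_eq] using hxy i (mem_univ i)
    _ ≤ δ := by
        rw [Finset.sum_const, Finset.card_univ, Fintype.card_fin, nsmul_eq_mul,
          ← mul_div_assoc, div_le_iff₀ (by positivity)]
        linarith

/-- Locally, membership in a lens is decided by finitely many sets that are open for larger cone
families. -/
theorem NLens.exists_local_opens {S : Set (Euc n)} (hS : NLens X 𝒩 S) {x : Euc n} (hx : x ∈ X) :
    ∃ O, IsOpen O ∧ x ∈ O ∧ ∃ 𝒰 : Set (Set (Euc n)), 𝒰.Finite ∧
      (∀ U ∈ 𝒰, IsOpen U ∧ ∀ y ∈ O, NOpenAt X 𝒩 U y) ∧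
      ∀ y ∈ O, ∀ z ∈ O, (∀ U ∈ 𝒰, y ∈ U ↔ z ∈ U) → (y ∈ S ↔ z ∈ S) := by
  by_cases hxS : x ∈ closure S
  · obtain ⟨V, 𝒩', hV, hxV, hVX, hc, hs, U₁, U₂, h1, h2, e⟩ := hS.1.2 x ⟨hxS, hx⟩
    have hat : ∀ U, NOpen V 𝒩' U → IsOpen U ∧ ∀ y ∈ V, NOpenAt X 𝒩 U y := fun U hU =>
      ⟨hU.2.1, fun y hy => ⟨V, 𝒩', hV, hy, hVX, hc, hs, by
        rwa [inter_eq_self_of_subset_left hU.1]⟩⟩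
    refine ⟨V, hV, hxV, {U₁, U₂}, by simp, ?_, fun y hy z hz h => ?_⟩
    · rintro U (rfl | rfl)
      · exact hat _ h1
      · exact hat _ h2
    · have a := Set.ext_iff.1 e y
      have b := Set.ext_iff.1 e z
      have c := h U₁ (by simp)
      have d := h U₂ (by simp)
      simp only [mem_inter_iff, mem_sdiff] at a b
      tauto
  · refine ⟨(closure S)ᶜ, isClosed_closure.isOpen_compl, hxS, ∅, finite_empty, by simp,
      fun y hy z hz _ => ?_⟩
    exact iff_of_false (fun h => hy (subset_closure h)) fun h => hz (subset_closure h)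

/-- A lens can be cut along another lens. -/
theorem NLens.separates_mem (h𝒩 : IsConeFam X 𝒩) (hX : IsOpen X) {A S : Set (Euc n)}
    (hA : NLens X 𝒩 A) (hS : NLens X 𝒩 S) : Separates X 𝒩 A (fun x y => x ∈ S ↔ y ∈ S) := by
  choose! O hO hxO 𝒰 h𝒰f h𝒰 hdec using fun x (hx : x ∈ X) => hS.exists_local_opens hx
  obtain ⟨δ, hδ, hleb⟩ := lebesgue_number_lemma_of_metric hA.2.1
    (c := fun i : X => O i) (fun i => hO i i.2)
    (fun x hx => mem_iUnion.2 ⟨⟨x, hx.2⟩, hxO x hx.2⟩)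
  intro B hBA hB
  obtain ⟨ρ, hρ⟩ := (hA.separates_dist_le h𝒩 hX (half_pos hδ)) B hBA hB
  suffices h : ∀ c, ∃ σ, IsLensRank X 𝒩 (B ∩ ρ ⁻¹' {c}) σ (fun x y => x ∈ S ↔ y ∈ S) by
    obtain ⟨τ, hτ1, hτ2, hτ3⟩ := hρ.lex h
    exact ⟨τ, hτ1, hτ2, fun x hx y hy e => (hτ3 x hx y hy e).2⟩
  intro c
  rcases (B ∩ ρ ⁻¹' {c}).eq_empty_or_nonempty with he | ⟨x, hxB, hxc⟩
  · rw [he]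
    exact ⟨0, ⟨⟨0, by simp⟩, by simp⟩, fun c => by simpa using nLens_empty, by simp⟩
  obtain ⟨⟨i, hi⟩, hball⟩ := hleb x (hA.subset_closure_inter (hBA hxB))
  have hT : closure (B ∩ ρ ⁻¹' {c}) ⊆ O i := by
    refine (closure_minimal ?_ Metric.isClosed_closedBall).trans
      ((Metric.closedBall_subset_ball (half_lt_self hδ)).trans hball)
    exact fun y hy => hρ.2.2 y hy.1 x hxB (hy.2.trans hxc.symm)
  refine ((Separates.forall_mem (h𝒰f i hi) fun U hU => separates_of_nOpenAt h𝒩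
    (h𝒰 i hi U hU).1 fun y hy => (h𝒰 i hi U hU).2 y (hT hy.1)).mono
      fun y hy z hz h => ?_) _ Subset.rfl (hρ.2.1 c)
  exact hdec i hi y (hT (subset_closure hy)) z (hT (subset_closure hz)) h

/-- A lens can be cut along finitely many lenses. -/
theorem NLens.exists_isLensRank (h𝒩 : IsConeFam X 𝒩) (hX : IsOpen X) {A : Set (Euc n)}
    (hA : NLens X 𝒩 A) {Q : Set (Set (Euc n))} (hQf : Q.Finite) (hQ : ∀ S ∈ Q, NLens X 𝒩 S) :
    ∃ ρ, IsLensRank X 𝒩 A ρ (fun x y => ∀ S ∈ Q, x ∈ S ↔ y ∈ S) :=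
  Separates.forall_mem hQf (fun S hS => hA.separates_mem h𝒩 hX (hQ S hS)) A Subset.rfl hA

/-- The set of nonempty fibres of `ρ` on `A`. -/
def fibers (A : Set (Euc n)) (ρ : Euc n → ℕ) : Set (Set (Euc n)) :=
  (fun x => A ∩ ρ ⁻¹' {ρ x}) '' A

theorem IsRank.finite_fibers {A : Set (Euc n)} {ρ : Euc n → ℕ} (h : IsRank A ρ) :
    (fibers A ρ).Finite := by
  obtain ⟨⟨m, hm⟩, -⟩ := h
  refine ((finite_Iio m).image fun c => A ∩ ρ ⁻¹' {c}).subset ?_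
  rintro _ ⟨x, hx, rfl⟩
  exact ⟨ρ x, hm x hx, rfl⟩

/-- The fibres of a rank function come from a closed filtration. -/
theorem IsRank.comesFromClosedFiltration {A : Set (Euc n)} {ρ : Euc n → ℕ} (h : IsRank A ρ) :
    ComesFromClosedFiltration A (fibers A ρ) := by
  obtain ⟨⟨m, hm⟩, h⟩ := h
  refine ⟨m, fun i => A ∩ {x | ρ x < i}, by simp, ?_, fun i _ x hx => ⟨hx.1, ?_⟩,
    fun i _ => ?_, ?_⟩
  · exact inter_eq_left.2 hm
  · exact Nat.lt_succ_of_lt hx.2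
  · choose! O hO hxO hle using h
    refine ⟨(⋃ x ∈ A ∩ {x | i ≤ ρ x}, O x)ᶜ,
      (isOpen_biUnion fun x hx => hO x hx.1).isClosed_compl, ?_⟩
    ext x
    simp only [mem_inter_iff, mem_ofPred_eq, mem_compl_iff, mem_iUnion, not_exists]
    constructor
    · rintro ⟨hx, hlt⟩
      exact ⟨fun y hy hxy => absurd (hy.2.trans (hle y hy.1 x ⟨hx, hxy⟩)) hlt.not_ge, hx⟩
    · rintro ⟨hn, hx⟩
      exact ⟨hx, not_le.1 fun hi => hn x ⟨hx, hi⟩ (hxO x hx)⟩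
  · have hfib : ∀ i, 1 ≤ i → (A ∩ {x | ρ x < i}) \ (A ∩ {x | ρ x < i - 1}) =
        A ∩ ρ ⁻¹' {i - 1} := fun i hi => by
      ext x
      simp only [mem_sdiff, mem_inter_iff, mem_ofPred_eq, mem_preimage, mem_singleton_iff, not_and,
        not_lt]
      constructor
      · rintro ⟨⟨hx, h1⟩, h2⟩
        have := h2 hx
        exact ⟨hx, by omega⟩
      · rintro ⟨hx, e⟩
        exact ⟨⟨hx, by omega⟩, fun _ => by omega⟩
    ext C
    constructor
    · rintro ⟨x, hx, rfl⟩
      refine ⟨⟨x, hx, rfl⟩, ρ x + 1, by omega, hm x hx, ?_⟩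
      rw [hfib _ (by omega), Nat.add_sub_cancel]
    · rintro ⟨⟨x, hx⟩, i, hi, -, rfl⟩
      rw [hfib i hi] at hx ⊢
      refine ⟨x, hx.1, ?_⟩
      dsimp only
      rw [hx.2]

/-- A partition into lenses which restricts to the fibres of a rank function on a union `B` of
members is special on `B`. -/
theorem ParPrec.nSpecialPartition {Y B : Set (Euc n)} {R : Set (Set (Euc n))}
    (hR : ParPrec X 𝒩 Y R) (hBY : B ⊆ Y) (hB : ∀ C ∈ R, ∀ x ∈ C, x ∈ B → C ⊆ B)
    {τ : Euc n → ℕ} (hτ : IsRank B τ)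
    (h : ∀ x ∈ B, ∀ y ∈ B, τ x = τ y ↔ ∃ C ∈ R, x ∈ C ∧ y ∈ C) :
    NSpecialPartition X 𝒩 B {C | C ∈ R ∧ C ⊆ B} := by
  obtain ⟨⟨hfin, hne, hdis, hU⟩, hl⟩ := hR
  have heq : ∀ C ∈ R, ∀ x ∈ C, x ∈ B → B ∩ τ ⁻¹' {τ x} = C := fun C hC x hx hxB => by
    ext y
    simp only [mem_inter_iff, mem_preimage, mem_singleton_iff]
    constructor
    · rintro ⟨hy, e⟩
      obtain ⟨D, hD, hyD, hxD⟩ := (h y hy x hxB).1 e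
      by_cases hCD : C = D
      · rwa [hCD]
      · exact absurd hxD (disjoint_left.1 (hdis C hC D hD hCD) hx)
    · intro hy
      have hyB := hB C hC x hx hxB hy
      exact ⟨hyB, (h y hyB x hxB).2 ⟨C, hC, hy, hx⟩⟩
  have hcover : ∀ x ∈ B, ∃ C ∈ R, x ∈ C := fun x hx => by
    have := hBY hx
    rwa [← hU] at this
  have hfib : {C | C ∈ R ∧ C ⊆ B} = fibers B τ := by
    ext C
    constructor
    · rintro ⟨hC, hCB⟩
      obtain ⟨x, hx⟩ := hne C hC
      exact ⟨x, hCB hx, heq C hC x hx (hCB hx)⟩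
    · rintro ⟨x, hx, rfl⟩
      obtain ⟨C, hC, hxC⟩ := hcover x hx
      dsimp only
      rw [heq C hC x hxC hx]
      exact ⟨hC, hB C hC x hxC hx⟩
  refine ⟨⟨hfin.subset fun C hC => hC.1, fun C hC => hne C hC.1,
    fun C hC D hD => hdis C hC.1 D hD.1, ?_⟩, ?_, fun C hC => hl C hC.1⟩
  · refine Subset.antisymm (sUnion_subset fun C hC => hC.2) fun x hx => ?_
    obtain ⟨C, hC, hxC⟩ := hcover x hx
    exact ⟨C, ⟨hC, hB C hC x hxC hx⟩, hxC⟩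
  · rw [hfib]
    exact hτ.comesFromClosedFiltration

/-- Refining each member of a partition into lenses by a lens rank function. -/
theorem ParPrec.refine {Y : Set (Euc n)} {P : Set (Set (Euc n))} (hP : ParPrec X 𝒩 Y P)
    {ρ : Set (Euc n) → Euc n → ℕ} {Φ : Euc n → Euc n → Prop}
    (hρ : ∀ A ∈ P, IsLensRank X 𝒩 A (ρ A) Φ) :
    ParPrec X 𝒩 Y (⋃ A ∈ P, fibers A (ρ A)) := by
  obtain ⟨⟨hfin, hne, hdis, hU⟩, hl⟩ := hP
  refine ⟨⟨hfin.biUnion fun A hA => (hρ A hA).1.finite_fibers, ?_, ?_, ?_⟩, ?_⟩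
  · intro C hC
    simp only [mem_iUnion] at hC
    obtain ⟨A, hA, x, hx, rfl⟩ := hC
    exact ⟨x, hx, rfl⟩
  · intro C hC D hD hCD
    simp only [mem_iUnion] at hC hD
    obtain ⟨A, hA, x, hx, rfl⟩ := hC
    obtain ⟨B, hB, y, hy, rfl⟩ := hD
    by_cases hAB : A = B
    · subst hAB
      refine disjoint_left.2 fun z hz hz' => hCD ?_
      have : ρ A x = ρ A y := hz.2.symm.trans hz'.2
      simp only [this]
    · exact (hdis A hA B hB hAB).mono inter_subset_left inter_subset_left
  · ext x
    simp only [mem_sUnion, mem_iUnion]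
    constructor
    · rintro ⟨C, ⟨A, hA, y, hy, rfl⟩, hx⟩
      rw [← hU]
      exact ⟨A, hA, hx.1⟩
    · intro hx
      rw [← hU] at hx
      obtain ⟨A, hA, hx⟩ := hx
      exact ⟨_, ⟨A, hA, x, hx, rfl⟩, hx, rfl⟩
  · intro C hC
    simp only [mem_iUnion] at hC
    obtain ⟨A, hA, x, hx, rfl⟩ := hC
    exact (hρ A hA).2.1 _

/-- Any two partitions into lenses of the same set have a common special refinement. -/
theorem ParPrec.exists_precRel (h𝒩 : IsConeFam X 𝒩) (hX : IsOpen X) {Y : Set (Euc n)}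
    {P Q : Set (Set (Euc n))} (hP : ParPrec X 𝒩 Y P) (hQ : ParPrec X 𝒩 Y Q) :
    ∃ R, ParPrec X 𝒩 Y R ∧ PrecRel X 𝒩 P R ∧ PrecRel X 𝒩 Q R := by
  choose! σ hσ using fun B (hB : B ∈ Q) => (hQ.2 B hB).exists_isLensRank h𝒩 hX hP.1.1 hP.2
  have hQ' := hQ.refine hσ
  choose! ρ hρ using fun A (hA : A ∈ P) => (hP.2 A hA).exists_isLensRank h𝒩 hX hQ'.1.1 hQ'.2
  have hR := hP.refine hρ
  set R := ⋃ A ∈ P, fibers A (ρ A) with hRdef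
  have hRmem : ∀ C ∈ R, ∃ A ∈ P, C ⊆ A ∧ ∀ x ∈ C, C = A ∩ ρ A ⁻¹' {ρ A x} := by
    intro C hC
    simp only [hRdef, mem_iUnion] at hC
    obtain ⟨A, hA, x, hx, rfl⟩ := hC
    refine ⟨A, hA, inter_subset_left, fun y hy => ?_⟩
    have : ρ A y = ρ A x := hy.2
    rw [this]
  have hmemR : ∀ A ∈ P, ∀ x ∈ A, A ∩ ρ A ⁻¹' {ρ A x} ∈ R := fun A hA x hx => by
    simp only [hRdef, mem_iUnion]
    exact ⟨A, hA, x, hx, rfl⟩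
  have hPeq : ∀ A ∈ P, ∀ A' ∈ P, ∀ x ∈ A, x ∈ A' → A = A' := fun A hA A' hA' x hx hx' => by
    by_contra hne
    exact disjoint_left.1 (hP.1.2.2.1 A hA A' hA' hne) hx hx'
  have hsameP : ∀ A ∈ P, ∀ x ∈ A, ∀ y ∈ A, ρ A x = ρ A y ↔ ∃ C ∈ R, x ∈ C ∧ y ∈ C := by
    intro A hA x hx y hy
    constructor
    · exact fun e => ⟨_, hmemR A hA x hx, ⟨hx, rfl⟩, hy, e.symm⟩
    · rintro ⟨C, hC, hxC, hyC⟩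
      obtain ⟨A', hA', hCA', hC'⟩ := hRmem C hC
      obtain rfl := hPeq A hA A' hA' x hx (hCA' hxC)
      rw [hC' x hxC] at hyC
      exact hyC.2.symm
  have hCQ' : ∀ C ∈ R, ∀ B ∈ Q, ∀ x ∈ C, x ∈ B → C ⊆ B ∩ σ B ⁻¹' {σ B x} := by
    intro C hC B hB x hxC hxB y hyC
    obtain ⟨A, hA, hCA, hC'⟩ := hRmem C hC
    have e : ρ A x = ρ A y := by
      rw [hC' x hxC] at hyC
      exact hyC.2.symm
    refine ((hρ A hA).2.2 x (hCA hxC) y (hCA hyC) e _ ?_).1 ⟨hxB, rfl⟩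
    simp only [mem_iUnion]
    exact ⟨B, hB, x, hxB, rfl⟩
  have hsub : ∀ {P' : Set (Set (Euc n))}, ParPrec X 𝒩 Y P' → ∀ A ∈ P', A ⊆ Y :=
    fun hP' A hA => hP'.1.2.2.2 ▸ subset_sUnion_of_mem hA
  refine ⟨R, hR, ⟨fun C hC => ?_, fun A hA => ?_⟩, ⟨fun C hC => ?_, fun B hB => ?_⟩⟩
  · obtain ⟨A, hA, hCA, -⟩ := hRmem C hC
    exact ⟨A, hA, hCA⟩
  · refine hR.nSpecialPartition (hsub hP A hA) (fun C hC x hxC hxA => ?_) (hρ A hA).1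
      (hsameP A hA)
    obtain ⟨A', hA', hCA', -⟩ := hRmem C hC
    rwa [hPeq A hA A' hA' x hxA (hCA' hxC)]
  · obtain ⟨x, hx⟩ := hR.1.2.1 C hC
    have hxY := hsub hR C hC hx
    rw [← hQ.1.2.2.2] at hxY
    obtain ⟨B, hB, hxB⟩ := hxY
    exact ⟨B, hB, (hCQ' C hC B hB x hx hxB).trans inter_subset_left⟩
  · have hcov : ∀ c, ∃ μ : Euc n → ℕ, IsRank (B ∩ σ B ⁻¹' {c}) μ ∧
        ∀ x ∈ B ∩ σ B ⁻¹' {c}, ∀ y ∈ B ∩ σ B ⁻¹' {c},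
          μ x = μ y ↔ ∃ C ∈ R, x ∈ C ∧ y ∈ C := by
      intro c
      rcases (B ∩ σ B ⁻¹' {c}).eq_empty_or_nonempty with he | ⟨x, hxB, hxc⟩
      · rw [he]
        exact ⟨0, ⟨⟨0, by simp⟩, by simp⟩, by simp⟩
      · have hxY := hsub hQ B hB hxB
        rw [← hP.1.2.2.2] at hxY
        obtain ⟨A, hA, hxA⟩ := hxY
        have hsubA : B ∩ σ B ⁻¹' {c} ⊆ A := fun y hy =>
          ((hσ B hB).2.2 x hxB y hy.1 (hxc.trans hy.2.symm) A hA).1 hxA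
        exact ⟨ρ A, (hρ A hA).1.mono hsubA,
          fun y hy z hz => hsameP A hA y (hsubA hy) z (hsubA hz)⟩
    choose μ hμ hμs using hcov
    obtain ⟨τ, hτ, e⟩ := (hσ B hB).1.lex hμ
    refine hR.nSpecialPartition (hsub hQ B hB)
      (fun C hC x hxC hxB => (hCQ' C hC B hB x hxC hxB).trans inter_subset_left) hτ
      fun x hx y hy => ?_
    rw [e x hx y hy]
    constructor
    · rintro ⟨e1, e2⟩
      exact (hμs _ x ⟨hx, rfl⟩ y ⟨hy, e1.symm⟩).1 e2
    · rintro ⟨C, hC, hxC, hyC⟩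
      have e1 : σ B y = σ B x := (hCQ' C hC B hB x hxC hx hyC).2
      exact ⟨e1.symm, (hμs _ x ⟨hx, rfl⟩ y ⟨hy, e1⟩).2 ⟨C, hC, hxC, hyC⟩⟩

/-- A part of `Y` cut out by a set `Z` compatible with a partition into lenses. -/
theorem ParPrec.sep {Y Z : Set (Euc n)} {P : Set (Set (Euc n))} (hP : ParPrec X 𝒩 Y P)
    (hZ : ∀ A ∈ P, ∀ x ∈ A, ∀ y ∈ A, x ∈ Z ↔ y ∈ Z) :
    ParPrec X 𝒩 (Y ∩ Z) {A | A ∈ P ∧ A ⊆ Z} := by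
  obtain ⟨⟨hfin, hne, hdis, hU⟩, hl⟩ := hP
  refine ⟨⟨hfin.subset fun C hC => hC.1, fun C hC => hne C hC.1,
    fun C hC D hD => hdis C hC.1 D hD.1, ?_⟩, fun C hC => hl C hC.1⟩
  ext x
  rw [← hU]
  constructor
  · rintro ⟨A, ⟨hA, hAZ⟩, hx⟩
    exact ⟨⟨A, hA, hx⟩, hAZ hx⟩
  · rintro ⟨⟨A, hA, hx⟩, hxZ⟩
    exact ⟨A, ⟨hA, fun y hy => (hZ A hA x hx y hy).1 hxZ⟩, hx⟩

/-- Refining a partition into lenses so that it becomes compatible with another set admitting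
one. -/
theorem ParPrec.exists_compatible (h𝒩 : IsConeFam X 𝒩) (hX : IsOpen X) {Y Z : Set (Euc n)}
    {P Q : Set (Set (Euc n))} (hP : ParPrec X 𝒩 Y P) (hQ : ParPrec X 𝒩 Z Q) :
    ∃ R, ParPrec X 𝒩 Y R ∧ ∀ A ∈ R, ∀ x ∈ A, ∀ y ∈ A, x ∈ Z ↔ y ∈ Z := by
  choose! ρ hρ using fun A (hA : A ∈ P) => (hP.2 A hA).exists_isLensRank h𝒩 hX hQ.1.1 hQ.2
  refine ⟨_, hP.refine hρ, fun C hC x hx y hy => ?_⟩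
  simp only [mem_iUnion] at hC
  obtain ⟨A, hA, z, hz, rfl⟩ := hC
  have := (hρ A hA).2.2 x hx.1 y hy.1 (hx.2.trans hy.2.symm)
  rw [← hQ.1.2.2.2]
  simp only [mem_sUnion]
  exact exists_congr fun B => and_congr_right fun hB => this B hB

theorem ParPrec.union {Y Z : Set (Euc n)} {P Q : Set (Set (Euc n))} (hP : ParPrec X 𝒩 Y P)
    (hQ : ParPrec X 𝒩 Z Q) (hYZ : Disjoint Y Z) : ParPrec X 𝒩 (Y ∪ Z) (P ∪ Q) := by
  obtain ⟨⟨hfin, hne, hdis, hU⟩, hl⟩ := hP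
  obtain ⟨⟨hfin', hne', hdis', hU'⟩, hl'⟩ := hQ
  have hPQ : ∀ A ∈ P, ∀ B ∈ Q, Disjoint A B := fun A hA B hB =>
    hYZ.mono (hU ▸ subset_sUnion_of_mem hA) (hU' ▸ subset_sUnion_of_mem hB)
  refine ⟨⟨hfin.union hfin', fun A hA => hA.elim (hne A) (hne' A), ?_, ?_⟩,
    fun A hA => hA.elim (hl A) (hl' A)⟩
  · rintro A (hA | hA) B (hB | hB) hAB
    · exact hdis A hA B hB hAB
    · exact hPQ A hA B hB
    · exact (hPQ B hB A hA).symm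
    · exact hdis' A hA B hB hAB
  · rw [sUnion_union, hU, hU']

theorem NLens.exists_parPrec {A : Set (Euc n)} (hA : NLens X 𝒩 A) : ∃ P, ParPrec X 𝒩 A P := by
  rcases A.eq_empty_or_nonempty with rfl | hne
  · exact ⟨∅, ⟨finite_empty, by simp, by simp, by simp⟩, by simp⟩
  · refine ⟨{A}, ⟨finite_singleton _, by simpa using hne, ?_, by simp⟩, by simpa using hA⟩
    rintro _ rfl _ rfl h
    exact absurd rfl h

theorem NConstructible.exists_parPrec (h𝒩 : IsConeFam X 𝒩) (hX : IsOpen X) {Y : Set (Euc n)}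
    (hY : NConstructible X 𝒩 Y) : ∃ P, ParPrec X 𝒩 Y P := by
  have hdiff : ∀ A B : Set (Euc n), (∃ P, ParPrec X 𝒩 A P) → (∃ P, ParPrec X 𝒩 B P) →
      ∃ P, ParPrec X 𝒩 (A \ B) P := by
    rintro A B ⟨P, hP⟩ ⟨Q, hQ⟩
    obtain ⟨R, hR, h⟩ := hP.exists_compatible h𝒩 hX hQ
    exact ⟨_, hR.sep (Z := Bᶜ) fun C hC x hx y hy => not_congr (h C hC x hx y hy)⟩
  induction hY with
  | lens Z hZ => exact hZ.exists_parPrec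
  | union A B _ _ hA hB =>
    obtain ⟨P, hP⟩ := hdiff A B hA hB
    obtain ⟨Q, hQ⟩ := hB
    exact ⟨_, sdiff_union_self (s := A) (t := B) ▸ hP.union hQ disjoint_sdiff_left⟩
  | inter A B _ _ hA hB =>
    obtain ⟨P, hP⟩ := hA
    obtain ⟨Q, hQ⟩ := hB
    obtain ⟨R, hR, h⟩ := hP.exists_compatible h𝒩 hX hQ
    exact ⟨_, hR.sep h⟩
  | diff A B _ _ hA hB => exact hdiff A B hA hB

end Lens

/-- for an `𝒩`-constructible `Y`, the set `Par^≺(Y)` of partitions of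
`Y` into `𝒩`-lenses is nonempty and directed under `⪯`. -/
theorem stmt_19 {n : ℕ} (X : Set (Euc n)) (hX : IsOpen X)
    (𝒩 : Set (Euc n × Euc n)) (h𝒩 : IsConeFam X 𝒩)
    (Y : Set (Euc n)) (hY : NConstructible X 𝒩 Y) :
    (∃ Ps : Set (Set (Euc n)), ParPrec X 𝒩 Y Ps) ∧
    ∀ Ps Qs : Set (Set (Euc n)), ParPrec X 𝒩 Y Ps → ParPrec X 𝒩 Y Qs →
      ∃ Rs : Set (Set (Euc n)), ParPrec X 𝒩 Y Rs ∧
        PrecRel X 𝒩 Ps Rs ∧ PrecRel X 𝒩 Qs Rs := by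
  exact ⟨hY.exists_parPrec h𝒩 hX, fun _ _ hP hQ => hP.exists_precRel h𝒩 hX hQ⟩
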